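/- arXiv:1403.6387 — 5 statements merged into one kernel-verified Lean document; each statement's English description precedes it below -/
import Mathlib

section
/- Let n ≥ 1 and let G be a connected simple graph on Fin n with edge set E. For every matrix z ∈ Matrix Q Q ℂ, one has Σ_{{j,k} ∈ E} (U_{jk} * z * U_{jk} − z) = 0 if and only if P*(z) = z. -/
open Matrix
/-- The state space of an `n`-qubit register under the standard computational basis:
functions from `Fin n` to `Fin 2`. -/
abbrev Qn (n : ℕ) := Fin n → Fin 2

/-- The permutation matrix `U_π` acting on `Matrix (Qn n) (Qn n) ℂ`:
`(U_π) f g = 1` if `f = g ∘ π` and `0` otherwise. -/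
def permMat {n : ℕ} (π : Equiv.Perm (Fin n)) : Matrix (Qn n) (Qn n) ℂ :=
  Matrix.of fun f g => if f = g ∘ π then 1 else 0

/-- The swapping operator between qubits `j` and `k`. -/
def uSwap {n : ℕ} (j k : Fin n) : Matrix (Qn n) (Qn n) ℂ :=
  permMat (Equiv.swap j k)

/-- The quantum average `P*(z) = (1/n!) Σ_π U_π z U_π†`. -/
noncomputable def pStar {n : ℕ} (z : Matrix (Qn n) (Qn n) ℂ) : Matrix (Qn n) (Qn n) ℂ :=
  ((n.factorial : ℂ))⁻¹ • ∑ π : Equiv.Perm (Fin n), permMat π * z * (permMat π)ᴴ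

/-- The set of edges of `G`, encoded as the ordered pairs `(j, k)` with `j < k`
and `{j,k} ∈ E`; each undirected edge appears exactly once. -/
def edgePairs {n : ℕ} (G : SimpleGraph (Fin n)) [DecidableRel G.Adj] :
    Finset (Fin n × Fin n) :=
  Finset.univ.filter fun p => G.Adj p.1 p.2 ∧ p.1 < p.2

/-- If the differences of `w` along finitely many permutations sum to zero at each point, then
`w` is invariant under each of these permutations. -/
theorem apply_perm_eq_of_sum_sub_eq_zero {X ι : Type*} [Fintype X] (s : Finset ι)
    (σ : ι → Equiv.Perm X) (w : X → ℂ) (h : ∀ x, ∑ i ∈ s, (w (σ i x) - w x) = 0)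
    {i : ι} (hi : i ∈ s) (x : X) : w (σ i x) = w x := by
  have key (a b : ℂ) : Complex.normSq (b - a) =
      Complex.normSq b - Complex.normSq a - 2 * ((starRingEnd ℂ) a * (b - a)).re := by
    simp only [Complex.normSq_apply, Complex.sub_re, Complex.sub_im, Complex.mul_re,
      Complex.conj_re, Complex.conj_im]
    ring
  have hsum : ∑ i ∈ s, ∑ x, Complex.normSq (w (σ i x) - w x) = 0 := by
    have h_inv (i : ι) : ∑ x, Complex.normSq (w (σ i x)) = ∑ x, Complex.normSq (w x) :=
      Equiv.sum_comp (σ i) fun x => Complex.normSq (w x)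
    have hzero : ∑ i ∈ s, ∑ x, ((starRingEnd ℂ) (w x) * (w (σ i x) - w x)).re = 0 := by
      rw [Finset.sum_comm]
      refine Finset.sum_eq_zero fun x _ => ?_
      rw [← Complex.re_sum, ← Finset.mul_sum, h x, mul_zero, Complex.zero_re]
    simp only [key, Finset.sum_sub_distrib, h_inv, sub_self, ← Finset.mul_sum, hzero, mul_zero,
      Finset.sum_const_zero]
  have hnonneg (i : ι) : 0 ≤ ∑ x, Complex.normSq (w (σ i x) - w x) :=
    Finset.sum_nonneg fun x _ => Complex.normSq_nonneg _
  have hx := (Finset.sum_eq_zero_iff_of_nonneg fun i _ => hnonneg i).1 hsum i hi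
  have := (Finset.sum_eq_zero_iff_of_nonneg fun x _ => Complex.normSq_nonneg _).1 hx x
    (Finset.mem_univ x)
  exact sub_eq_zero.1 (Complex.normSq_eq_zero.1 this)

/-- A subgroup of permutations containing the transpositions along the edges of a connected graph
is the full symmetric group. -/
theorem SimpleGraph.Connected.subgroup_perm_eq_top {V : Type*} [Finite V] [DecidableEq V]
    {G : SimpleGraph V} (hG : G.Connected) (H : Subgroup (Equiv.Perm V))
    (h : ∀ u v, G.Adj u v → Equiv.swap u v ∈ H) : H = ⊤ := by
  have hwalk {u v : V} (p : G.Walk u v) : Equiv.swap u v ∈ H := by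
    induction p with
    | @nil u => exact Equiv.swap_self u ▸ H.one_mem
    | cons hadj _ ih => exact SubmonoidClass.swap_mem_trans H (h _ _ hadj) ih
  rw [eq_top_iff, ← Equiv.Perm.closure_isSwap, Subgroup.closure_le]
  rintro _ ⟨u, v, -, rfl⟩
  exact hwalk (hG.preconnected u v).some

theorem permMat_conj_apply {n : ℕ} (π : Equiv.Perm (Fin n)) (z : Matrix (Qn n) (Qn n) ℂ)
    (f g : Qn n) :
    (permMat π * z * (permMat π)ᴴ) f g = z (f ∘ π.symm) (g ∘ π.symm) := by
  have hiff (f a : Qn n) : f = a ∘ π ↔ f ∘ π.symm = a := (Equiv.comp_symm_eq π a f).symm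
  simp [Matrix.mul_apply, permMat, hiff, apply_ite]

theorem uSwap_conjTranspose {n : ℕ} (j k : Fin n) :
    (uSwap j k)ᴴ = uSwap j k := by
  have hiff (f g : Qn n) : g = f ∘ Equiv.swap j k ↔ f = g ∘ Equiv.swap j k := by
    rw [← Equiv.comp_symm_eq, Equiv.symm_swap, eq_comm]
  ext f g
  simp [uSwap, permMat, hiff f g, apply_ite]

theorem uSwap_conj_apply {n : ℕ} (j k : Fin n) (z : Matrix (Qn n) (Qn n) ℂ) (f g : Qn n) :
    (uSwap j k * z * uSwap j k) f g = z (f ∘ Equiv.swap j k) (g ∘ Equiv.swap j k) := by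
  nth_rewrite 2 [← uSwap_conjTranspose j k]
  exact permMat_conj_apply _ z f g

/-- The permutations of the qubits under which `z` is invariant. -/
def permStabilizer {n : ℕ} (z : Matrix (Qn n) (Qn n) ℂ) : Subgroup (Equiv.Perm (Fin n)) where
  carrier := {π | ∀ f g, z (f ∘ π) (g ∘ π) = z f g}
  one_mem' _ _ := rfl
  mul_mem' {π τ} hπ hτ f g := (hτ (f ∘ π) (g ∘ π)).trans (hπ f g)
  inv_mem' {π} hπ f g := by
    have := hπ (f ∘ π.symm) (g ∘ π.symm)
    simpa [Function.comp_assoc] using this.symm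

theorem mem_permStabilizer {n : ℕ} {z : Matrix (Qn n) (Qn n) ℂ} {π : Equiv.Perm (Fin n)} :
    π ∈ permStabilizer z ↔ ∀ f g, z (f ∘ π) (g ∘ π) = z f g :=
  Iff.rfl

theorem pStar_apply {n : ℕ} (z : Matrix (Qn n) (Qn n) ℂ) (f g : Qn n) :
    pStar z f g = (n.factorial : ℂ)⁻¹ * ∑ π : Equiv.Perm (Fin n), z (f ∘ π) (g ∘ π) := by
  simp only [pStar, Matrix.smul_apply, Matrix.sum_apply, permMat_conj_apply, smul_eq_mul]
  congr 1
  exact Equiv.sum_comp (Equiv.inv (Equiv.Perm (Fin n))) fun π => z (f ∘ π) (g ∘ π)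

theorem pStar_eq_self_iff {n : ℕ} (z : Matrix (Qn n) (Qn n) ℂ) :
    pStar z = z ↔ permStabilizer z = ⊤ := by
  constructor
  · refine fun h => eq_top_iff.2 fun τ _ f g => ?_
    rw [← h, pStar_apply, pStar_apply]
    congr 1
    exact Equiv.sum_comp (Equiv.mulLeft τ) fun π => z (f ∘ π) (g ∘ π)
  · intro h
    ext f g
    have hz (π : Equiv.Perm (Fin n)) : z (f ∘ π) (g ∘ π) = z f g :=
      mem_permStabilizer.1 (h ▸ Subgroup.mem_top π) f g
    simp [pStar_apply, hz, Fintype.card_perm, Nat.factorial_ne_zero]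

/-- for a connected quantum interaction graph `G`,
`Σ_{{j,k} ∈ E} (U_{jk} z U_{jk} - z) = 0` iff `P*(z) = z`. -/
theorem sum_swap_conj_eq_zero_iff_pStar_fixed
    (n : ℕ) (hn : 1 ≤ n) (G : SimpleGraph (Fin n)) [DecidableRel G.Adj]
    (hG : G.Connected) (z : Matrix (Qn n) (Qn n) ℂ) :
    (∑ p ∈ edgePairs G, (uSwap p.1 p.2 * z * uSwap p.1 p.2 - z)) = 0 ↔
      pStar z = z := by
  rw [pStar_eq_self_iff]
  constructor
  · intro h
    let σ (p : Fin n × Fin n) : Equiv.Perm (Qn n × Qn n) :=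
      let e := Equiv.arrowCongr (Equiv.swap p.1 p.2) (Equiv.refl (Fin 2))
      Equiv.prodCongr e e
    have hedge (p : Fin n × Fin n) (hp : p ∈ edgePairs G) :
        Equiv.swap p.1 p.2 ∈ permStabilizer z := fun f g => by
      refine apply_perm_eq_of_sum_sub_eq_zero (edgePairs G) σ (fun x => z x.1 x.2)
        (fun x => ?_) hp (f, g)
      have hx := congrFun (congrFun h x.1) x.2
      simp only [Matrix.sum_apply, Matrix.sub_apply, uSwap_conj_apply] at hx
      exact hx
    refine hG.subgroup_perm_eq_top _ fun u v huv => ?_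
    rcases huv.ne.lt_or_gt with hlt | hlt
    · exact hedge (u, v) (by simp [edgePairs, huv, hlt])
    · rw [Equiv.swap_comm]
      exact hedge (v, u) (by simp [edgePairs, huv.symm, hlt])
  · intro h
    refine Finset.sum_eq_zero fun p _ => sub_eq_zero.2 ?_
    ext f g
    rw [uSwap_conj_apply]
    exact mem_permStabilizer.1 (h ▸ Subgroup.mem_top _) f g
end

section
/- Let n ≥ 1 and let G be any simple graph on Fin n with edge set E. For every matrix z ∈ Matrix Q Q ℂ, one has Σ_{{j,k} ∈ E} (U_{jk} * z * U_{jk} − z) = 0 if and only if U_{jk} * z * U_{jk} = z for every edge {j,k} ∈ E. -/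
open Matrix
theorem uSwap_mul_self {n : ℕ} (j k : Fin n) : uSwap j k * uSwap j k = 1 := by
  ext f g
  have h : (g ∘ Equiv.swap j k) ∘ Equiv.swap j k = g := by
    ext x
    simp
  simp [uSwap, permMat, Matrix.mul_apply, Matrix.one_apply, h]

theorem uSwap_comm {n : ℕ} (j k : Fin n) : uSwap j k = uSwap k j := by
  rw [uSwap, Equiv.swap_comm, uSwap]

/-- Conjugation by a Hermitian involution `u` moves `z` by `d = u z u - z`, whose squared
Frobenius norm is `-2 tr (zᴴ d)`. -/
theorem trace_conjTranspose_mul_self_conj_sub {m : Type*} [Fintype m] [DecidableEq m]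
    {u : Matrix m m ℂ} (z : Matrix m m ℂ) (hu : uᴴ = u) (huu : u * u = 1) :
    ((u * z * u - z)ᴴ * (u * z * u - z)).trace = -2 * (zᴴ * (u * z * u - z)).trace := by
  have hd : u * (u * z * u - z) * u = -(u * z * u - z) := by
    calc u * (u * z * u - z) * u = (u * u) * z * (u * u) - u * z * u := by noncomm_ring
      _ = -(u * z * u - z) := by rw [huu]; noncomm_ring
  generalize hD : u * z * u - z = d at hd
  have hDH : dᴴ = u * zᴴ * u - zᴴ := by
    simp [← hD, hu, Matrix.mul_assoc]
  have ht : (u * zᴴ * u * d).trace = -(zᴴ * d).trace := by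
    rw [← Matrix.trace_neg, ← Matrix.mul_neg, ← hd, Matrix.mul_assoc, Matrix.mul_assoc,
      Matrix.trace_mul_comm]
    simp only [Matrix.mul_assoc]
  rw [hDH, Matrix.sub_mul, Matrix.trace_sub, ht]
  ring

/-- A sum of displacements of `z` under Hermitian involutions vanishes iff each one does. -/
theorem sum_conj_sub_eq_zero_iff {ι m : Type*} [Fintype m] [DecidableEq m] (s : Finset ι)
    (u : ι → Matrix m m ℂ) (hu : ∀ i, (u i)ᴴ = u i) (huu : ∀ i, u i * u i = 1)
    (z : Matrix m m ℂ) :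
    ∑ i ∈ s, (u i * z * u i - z) = 0 ↔ ∀ i ∈ s, u i * z * u i = z := by
  open scoped ComplexOrder in
  refine ⟨fun h => ?_, fun h => Finset.sum_eq_zero fun i hi => sub_eq_zero.mpr (h i hi)⟩
  have hs : ∑ i ∈ s, ((u i * z * u i - z)ᴴ * (u i * z * u i - z)).trace = 0 := by
    simp_rw [fun i => trace_conjTranspose_mul_self_conj_sub z (hu i) (huu i)]
    rw [← Finset.mul_sum, ← Matrix.trace_sum, ← Matrix.mul_sum, h]
    simp
  rw [Finset.sum_eq_zero_iff_of_nonneg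
    fun i _ => (Matrix.posSemidef_conjTranspose_mul_self _).trace_nonneg] at hs
  exact fun i hi => sub_eq_zero.mp (Matrix.trace_conjTranspose_mul_self_eq_zero_iff.mp (hs i hi))

/-- for any quantum interaction graph `G`,
`Σ_{{j,k} ∈ E} (U_{jk} z U_{jk} - z) = 0` iff `U_{jk} z U_{jk} = z` for every edge `{j,k} ∈ E`. -/
theorem sum_swap_conj_eq_zero_iff_each_edge_fixed
    (n : ℕ) (hn : 1 ≤ n) (G : SimpleGraph (Fin n)) [DecidableRel G.Adj]
    (z : Matrix (Qn n) (Qn n) ℂ) :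
    (∑ p ∈ edgePairs G, (uSwap p.1 p.2 * z * uSwap p.1 p.2 - z)) = 0 ↔
      ∀ j k : Fin n, G.Adj j k → uSwap j k * z * uSwap j k = z := by
  rw [sum_conj_sub_eq_zero_iff (edgePairs G) (fun p => uSwap p.1 p.2)
    (fun p => uSwap_conjTranspose p.1 p.2) (fun p => uSwap_mul_self p.1 p.2)]
  refine ⟨fun h j k hjk => ?_, fun h p hp => h p.1 p.2 (Finset.mem_filter.mp hp).2.1⟩
  rcases hjk.ne.lt_or_gt with hlt | hlt
  · exact h (j, k) (by simp [edgePairs, hjk, hlt])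
  · rw [uSwap_comm]
    exact h (k, j) (by simp [edgePairs, hjk.symm, hlt])
end

section
/- Let n ≥ 1. For every (q, p) ∈ Q × Q, the orbit {(q ∘ π, p ∘ π) : π a permutation of Fin n} has cardinality at most (Nat.choose n ⌊n/2⌋)², and there exists (q, p) ∈ Q × Q whose orbit has cardinality at least Nat.choose n ⌊n/2⌋. (Note Nat.choose n ⌊n/2⌋ = max_{0 ≤ k ≤ n} Nat.choose n k; by the reachability characterization, these orbits are exactly the vertex sets of the connected components of the induced graph of any connected interaction graph, so the largest component size lies in the interval [max_k C(n,k), (max_k C(n,k))²].) -/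
/-- The positions at which a basis state carries the value `1`. -/
def onesSupport {n : ℕ} (q : Qn n) : Finset (Fin n) :=
  Finset.univ.filter fun i => q i = 1

@[simp]
theorem mem_onesSupport {n : ℕ} {q : Qn n} {i : Fin n} : i ∈ onesSupport q ↔ q i = 1 := by
  simp [onesSupport]

theorem onesSupport_injective (n : ℕ) : Function.Injective (onesSupport (n := n)) := by
  intro q r h
  funext i
  have hi : q i = 1 ↔ r i = 1 := by rw [← mem_onesSupport, h, mem_onesSupport]
  omega

theorem onesSupport_surjective (n : ℕ) : Function.Surjective (onesSupport (n := n)) := by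
  intro s
  refine ⟨fun i => if i ∈ s then 1 else 0, ?_⟩
  ext i
  by_cases hi : i ∈ s <;> simp [hi]

/-- Two basis states are related by a permutation iff they have the same number of ones. -/
theorem exists_eq_comp_perm_iff {n : ℕ} (q r : Qn n) :
    (∃ π : Equiv.Perm (Fin n), r = q ∘ ⇑π) ↔ (onesSupport r).card = (onesSupport q).card := by
  constructor
  · rintro ⟨π, rfl⟩
    exact Finset.card_equiv π fun i => by simp
  · intro h
    let e : {i // i ∈ onesSupport r} ≃ {i // i ∈ onesSupport q} := Finset.equivOfCardEq h
    refine ⟨e.extendSubtype, ?_⟩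
    funext i
    have hi : r i = 1 ↔ q (e.extendSubtype i) = 1 := by
      simp only [← mem_onesSupport]
      exact ⟨e.extendSubtype_mem i, fun hq => by_contra fun hr => e.extendSubtype_not_mem i hr hq⟩
    rw [Function.comp_apply]
    omega

theorem ncard_setOf_card_onesSupport_eq (n k : ℕ) :
    {r : Qn n | (onesSupport r).card = k}.ncard = n.choose k := by
  have himage : onesSupport '' {r : Qn n | (onesSupport r).card = k} =
      (Finset.powersetCard k (Finset.univ : Finset (Fin n)) : Set (Finset (Fin n))) := by
    ext s
    obtain ⟨r, rfl⟩ := onesSupport_surjective n s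
    simp [(onesSupport_injective n).eq_iff]
  rw [← Set.ncard_image_of_injective _ (onesSupport_injective n), himage,
    Set.ncard_coe_finset, Finset.card_powersetCard, Finset.card_univ, Fintype.card_fin]

/-- The permutation orbit of a single basis state is counted by a binomial coefficient. -/
theorem ncard_perm_orbit {n : ℕ} (q : Qn n) :
    {r : Qn n | ∃ π : Equiv.Perm (Fin n), r = q ∘ ⇑π}.ncard =
      n.choose (onesSupport q).card := by
  simp_rw [exists_eq_comp_perm_iff]
  exact ncard_setOf_card_onesSupport_eq n _

/-- every diagonal-permutation orbit in `Qn n × Qn n` has cardinality at most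
`(n.choose ⌊n/2⌋)²`, and some orbit has cardinality at least `n.choose ⌊n/2⌋`
(note `n.choose ⌊n/2⌋ = max_k n.choose k`). -/
theorem orbit_card_bounds (n : ℕ) (hn : 1 ≤ n) :
    (∀ q p : Qn n,
        {v : Qn n × Qn n | ∃ π : Equiv.Perm (Fin n), v = (q ∘ ⇑π, p ∘ ⇑π)}.ncard ≤
          (n.choose (n / 2)) ^ 2) ∧
      (∃ q p : Qn n,
        n.choose (n / 2) ≤
          {v : Qn n × Qn n | ∃ π : Equiv.Perm (Fin n), v = (q ∘ ⇑π, p ∘ ⇑π)}.ncard) := by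
  constructor
  · intro q p
    calc _ ≤ ({r : Qn n | ∃ π : Equiv.Perm (Fin n), r = q ∘ ⇑π} ×ˢ
          {r : Qn n | ∃ π : Equiv.Perm (Fin n), r = p ∘ ⇑π}).ncard := by
          refine Set.ncard_le_ncard ?_ (Set.toFinite _)
          rintro _ ⟨π, rfl⟩
          exact ⟨⟨π, rfl⟩, ⟨π, rfl⟩⟩
      _ ≤ n.choose (n / 2) ^ 2 := by
          rw [Set.ncard_prod, ncard_perm_orbit, ncard_perm_orbit, sq]
          exact Nat.mul_le_mul (Nat.choose_le_middle _ _) (Nat.choose_le_middle _ _)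
  · obtain ⟨s, -, hs⟩ := Finset.exists_subset_card_eq
      (s := (Finset.univ : Finset (Fin n))) (n := n / 2)
      (by simpa using Nat.div_le_self n 2)
    obtain ⟨q, rfl⟩ := onesSupport_surjective n s
    refine ⟨q, q, ?_⟩
    rw [← hs, ← ncard_perm_orbit]
    refine le_trans (Set.ncard_le_ncard ?_ (Set.toFinite _))
      (Set.ncard_image_le (f := Prod.fst) (Set.toFinite _))
    rintro _ ⟨π, rfl⟩
    exact ⟨_, ⟨π, rfl⟩, rfl⟩
end

section
/- Let n ≥ 1 and let G be any simple graph on Fin n with edge set E. For every vertex (q, p) ∈ Q × Q, the degree of (q, p) in the induced graph 𝒢 satisfies: deg(q,p) ≤ 3n²/8 if n ≡ 0 (mod 4); deg(q,p) ≤ (3n² − 3)/8 if n ≡ 1 (mod 4); deg(q,p) ≤ (3n² − 4)/8 if n ≡ 2 (mod 4); and deg(q,p) ≤ (3n² − 3)/8 if n ≡ 3 (mod 4). -/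
/-- The set of neighbors of the vertex `(q, p)` in the induced graph of the quantum
interaction graph `G`: the vertices `(q ∘ swap j k, p ∘ swap j k)` for edges `{j,k}` of `G`,
excluding `(q, p)` itself. Its cardinality is the degree of `(q, p)`. -/
def nbrSet {n : ℕ} (G : SimpleGraph (Fin n)) (q p : Qn n) : Set (Qn n × Qn n) :=
  {v | v ≠ (q, p) ∧ ∃ j k : Fin n, G.Adj j k ∧
      v = (q ∘ Equiv.swap j k, p ∘ Equiv.swap j k)}

open Finset in
/-- The number of ordered pairs on which `c` agrees is the sum of the squared fiber sizes. -/
theorem card_filter_apply_eq_apply {α β : Type*} [Fintype α] [Fintype β] [DecidableEq β]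
    (c : α → β) :
    #{x : α × α | c x.1 = c x.2} = ∑ b, #{i | c i = b} ^ 2 := by
  rw [card_eq_sum_card_fiberwise (f := fun x : α × α => c x.1) (t := univ) (by simp)]
  refine sum_congr rfl fun b _ => ?_
  rw [sq, ← card_product]
  congr 1
  ext ⟨i, j⟩
  simp only [mem_filter, mem_univ, true_and, mem_product]
  grind

open Finset in
/-- Twice the number of bichromatic pairs, together with the squared fiber sizes, is at most the
number of all ordered pairs. -/
theorem two_mul_card_bichromatic_add_le {α β : Type*} [Fintype α] [LinearOrder α] [Fintype β]
    [DecidableEq β] (c : α → β) :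
    2 * #{x : α × α | x.1 < x.2 ∧ c x.1 ≠ c x.2} + ∑ b, #{i | c i = b} ^ 2 ≤
      Fintype.card α ^ 2 := by
  have hswap : #{x : α × α | x.1 < x.2 ∧ c x.1 ≠ c x.2} ≤
      #{x ∈ {x : α × α | c x.1 ≠ c x.2} | ¬ x.1 < x.2} := by
    refine card_le_card_of_injOn Prod.swap ?_ Prod.swap_injective.injOn
    rintro ⟨i, j⟩ h
    simp only [coe_filter, mem_filter, mem_univ, true_and, Set.mem_ofPred_eq, Prod.swap] at h ⊢
    exact ⟨h.2.symm, h.1.not_gt⟩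
  have hlt : #{x : α × α | x.1 < x.2 ∧ c x.1 ≠ c x.2} =
      #{x ∈ {x : α × α | c x.1 ≠ c x.2} | x.1 < x.2} := by
    rw [filter_filter]
    simp only [and_comm]
  have hne := card_filter_add_card_filter_not (s := {x : α × α | c x.1 ≠ c x.2})
    (fun x => x.1 < x.2)
  have hall := card_filter_add_card_filter_not (s := (univ : Finset (α × α)))
    (fun x => c x.1 = c x.2)
  rw [card_filter_apply_eq_apply, card_univ, Fintype.card_prod, ← sq] at hall
  simp only [ne_eq] at *
  omega

open Finset in
/-- The neighbors of `(q, p)` arise from pairs of positions at which `(q, p)` differs. -/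
theorem ncard_nbrSet_le {n : ℕ} (G : SimpleGraph (Fin n)) (q p : Qn n) :
    (nbrSet G q p).ncard ≤
      #{x : Fin n × Fin n | x.1 < x.2 ∧ (q x.1, p x.1) ≠ (q x.2, p x.2)} := by
  classical
  have hsub : nbrSet G q p ⊆
      (({x : Fin n × Fin n | x.1 < x.2 ∧ (q x.1, p x.1) ≠ (q x.2, p x.2)} : Finset _).image
        fun x => (q ∘ Equiv.swap x.1 x.2, p ∘ Equiv.swap x.1 x.2) : Finset (Qn n × Qn n)) := by
    rintro v ⟨hv, j, k, hjk, rfl⟩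
    have hne : (q j, p j) ≠ (q k, p k) := by
      intro h
      obtain ⟨hq, hp⟩ := Prod.mk.inj h
      refine hv (Prod.ext ?_ ?_) <;> ext i <;>
        simp only [Function.comp, Equiv.swap_apply_def] <;> grind
    simp only [coe_image, coe_filter, mem_univ, true_and, Set.mem_image, Set.mem_ofPred_eq]
    rcases lt_or_gt_of_ne hjk.ne with h | h
    · exact ⟨(j, k), ⟨h, hne⟩, rfl⟩
    · exact ⟨(k, j), ⟨h, hne.symm⟩, by simp only [Equiv.swap_comm]⟩
  refine (Set.ncard_le_ncard hsub (Finset.finite_toSet _)).trans ?_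
  rw [Set.ncard_coe_finset]
  exact card_image_le

/-- The sum of squares of integers with a given sum is smallest for a balanced family. -/
theorem two_mul_add_one_mul_sum_le {ι : Type*} [Fintype ι] (a : ι → ℤ) (k : ℤ) :
    (2 * k + 1) * ∑ i, a i ≤ ∑ i, a i ^ 2 + Fintype.card ι * (k * (k + 1)) := by
  have h : ∀ i, (2 * k + 1) * a i ≤ a i ^ 2 + k * (k + 1) := fun i => by
    rcases le_or_gt (a i) k with h | h <;> nlinarith
  calc (2 * k + 1) * ∑ i, a i = ∑ i, (2 * k + 1) * a i := Finset.mul_sum ..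
    _ ≤ ∑ i, (a i ^ 2 + k * (k + 1)) := Finset.sum_le_sum fun i _ => h i
    _ = _ := by simp [Finset.sum_add_distrib]

open Finset in
theorem two_mul_ncard_nbrSet_add_le {n : ℕ} (G : SimpleGraph (Fin n)) (q p : Qn n) (k : ℤ) :
    2 * ((nbrSet G q p).ncard : ℤ) + (2 * k + 1) * n ≤ n ^ 2 + 4 * (k * (k + 1)) := by
  have h₁ := ncard_nbrSet_le G q p
  have h₂ := two_mul_card_bichromatic_add_le fun i => (q i, p i)
  have h₃ := two_mul_add_one_mul_sum_le
    (fun b : Fin 2 × Fin 2 => (#{i | (q i, p i) = b} : ℤ)) k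
  have h₄ : ∑ b, #{i | (q i, p i) = b} = n := by
    rw [← card_eq_sum_card_fiberwise (by simp), card_univ, Fintype.card_fin]
  rw [Fintype.card_fin] at h₂
  have h₂' := (Nat.add_le_add_right (Nat.mul_le_mul_left 2 h₁) _).trans h₂
  zify at h₂' h₄
  rw [h₄, Fintype.card_prod, Fintype.card_fin] at h₃
  push_cast at h₃
  linarith

/-- degree bounds in the induced graph, according to `n mod 4`. -/
theorem inducedGraph_degree_upper_bounds (n : ℕ) (hn : 1 ≤ n)
    (G : SimpleGraph (Fin n)) (q p : Qn n) :
    (n % 4 = 0 → (nbrSet G q p).ncard ≤ 3 * n ^ 2 / 8) ∧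
      (n % 4 = 1 → (nbrSet G q p).ncard ≤ (3 * n ^ 2 - 3) / 8) ∧
      (n % 4 = 2 → (nbrSet G q p).ncard ≤ (3 * n ^ 2 - 4) / 8) ∧
      (n % 4 = 3 → (nbrSet G q p).ncard ≤ (3 * n ^ 2 - 3) / 8) := by
  have h := two_mul_ncard_nbrSet_add_le G q p (n / 4 : ℕ)
  generalize (nbrSet G q p).ncard = d at h ⊢
  have hdiv := Nat.div_add_mod n 4
  generalize n / 4 = k at h hdiv
  refine ⟨fun hr => ?_, fun hr => ?_, fun hr => ?_, fun hr => ?_⟩ <;>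
  · rw [hr] at hdiv
    rw [Nat.le_div_iff_mul_le (by norm_num)]
    try apply Nat.le_sub_of_add_le
    subst hdiv
    zify
    push_cast at h
    linarith
end

section
/- Let n ≥ 1 and let G = K_n be the complete graph on Fin n (all pairs {j,k} with j ≠ k are edges). Then there exists a vertex (q, p) ∈ Q × Q whose degree in the induced graph 𝒢 equals: 3n²/8 if n ≡ 0 (mod 4); (3n² − 3)/8 if n ≡ 1 (mod 4); (3n² − 4)/8 if n ≡ 2 (mod 4); and (3n² − 3)/8 if n ≡ 3 (mod 4). -/
/-- The pairs `j < k < n` that are incongruent modulo `4`, indexed by the larger entry `k`. -/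
def incongruentPairs (n : ℕ) : Finset (Σ _ : ℕ, ℕ) :=
  (Finset.range n).sigma fun k => (Finset.range k).filter fun j => ¬ j ≡ k [MOD 4]

theorem mem_incongruentPairs {n : ℕ} {x : Σ _ : ℕ, ℕ} :
    x ∈ incongruentPairs n ↔ x.1 < n ∧ x.2 < x.1 ∧ x.2 % 4 ≠ x.1 % 4 := by
  rw [incongruentPairs, Finset.mem_sigma, Finset.mem_filter, Finset.mem_range, Finset.mem_range,
    Nat.ModEq]

theorem card_filter_not_modEq_four (k : ℕ) :
    ((Finset.range k).filter fun j => ¬ j ≡ k [MOD 4]).card = k - k / 4 := by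
  have h := Finset.card_filter_add_card_filter_not (s := Finset.range k) (fun j => j ≡ k [MOD 4])
  have hc := Nat.count_modEq_card k (r := 4) (by norm_num) k
  rw [Nat.count_eq_card_filter_range] at hc
  simp only [lt_irrefl, if_false, add_zero, Finset.card_range] at h hc
  omega

theorem card_incongruentPairs (n : ℕ) : (incongruentPairs n).card = 3 * n ^ 2 / 8 := by
  simp only [incongruentPairs, Finset.card_sigma, card_filter_not_modEq_four]
  induction n with
  | zero => simp
  | succ n ih =>
    rw [Finset.sum_range_succ, ih]
    obtain ⟨m, r, hr, rfl⟩ : ∃ m r, r < 4 ∧ n = 4 * m + r :=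
      ⟨n / 4, n % 4, Nat.mod_lt _ (by norm_num), (Nat.div_add_mod n 4).symm⟩
    interval_cases r <;> ring_nf <;> omega

/-- The colouring of `Fin n` by residues modulo `4`, encoded in two bits, with the residues
at `j` and `k` exchanged. -/
def swappedResidues (n j k : ℕ) : Qn n × Qn n :=
  (fun i => Fin.ofNat 2 (Equiv.swap j k i), fun i => Fin.ofNat 2 (Equiv.swap j k i / 2))

theorem swappedResidues_eq_iff {n j k j' k' : ℕ} :
    swappedResidues n j k = swappedResidues n j' k' ↔
      ∀ i < n, Equiv.swap j k i % 4 = Equiv.swap j' k' i % 4 := by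
  simp only [swappedResidues, Prod.mk.injEq, funext_iff, Fin.ext_iff, Fin.val_ofNat]
  constructor
  · rintro ⟨h₁, h₂⟩ i hi
    have := h₁ ⟨i, hi⟩
    have := h₂ ⟨i, hi⟩
    dsimp only at *
    omega
  · intro h
    constructor <;> intro i <;> have := h i i.2 <;> omega

theorem swappedResidues_comp_swap {n : ℕ} (j k : Fin n) :
    ((swappedResidues n 0 0).1 ∘ Equiv.swap j k, (swappedResidues n 0 0).2 ∘ Equiv.swap j k) =
      swappedResidues n j k := by
  ext i <;> simp [swappedResidues, Fin.val_injective.map_swap]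

theorem swappedResidues_ne_zero_iff {n j k : ℕ} (hj : j < n) :
    swappedResidues n j k ≠ swappedResidues n 0 0 ↔ j % 4 ≠ k % 4 := by
  rw [not_iff_not, swappedResidues_eq_iff]
  simp only [Equiv.swap_self, Equiv.refl_apply]
  constructor
  · intro h
    simpa using (h j hj).symm
  · intro h i _
    rw [Equiv.swap_apply_def]
    split_ifs <;> simp_all

theorem swappedResidues_injOn (n : ℕ) :
    Set.InjOn (fun x : Σ _ : ℕ, ℕ => swappedResidues n x.2 x.1) (incongruentPairs n) := by
  rintro ⟨k, j⟩ hx ⟨k', j'⟩ hx' h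
  rw [Finset.mem_coe, mem_incongruentPairs] at hx hx'
  dsimp only at hx hx' h
  rw [swappedResidues_eq_iff] at h
  have h₁ := h j (by omega)
  have h₂ := h k (by omega)
  have h₃ := h j' (by omega)
  have h₄ := h k' (by omega)
  simp only [Equiv.swap_apply_def] at h₁ h₂ h₃ h₄
  have : k = k' ∧ j = j' := by grind
  rw [this.1, this.2]

theorem nbrSet_top_swappedResidues (n : ℕ) :
    nbrSet (⊤ : SimpleGraph (Fin n)) (swappedResidues n 0 0).1 (swappedResidues n 0 0).2 =
      (fun x : Σ _ : ℕ, ℕ => swappedResidues n x.2 x.1) '' incongruentPairs n := by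
  ext v
  simp only [nbrSet, Set.mem_ofPred_eq, Set.mem_image, Finset.mem_coe, mem_incongruentPairs,
    swappedResidues_comp_swap, SimpleGraph.top_adj]
  constructor
  · rintro ⟨hv, j, k, hjk, rfl⟩
    have hne := (swappedResidues_ne_zero_iff j.2).1 hv
    rcases lt_or_gt_of_ne hjk with hlt | hlt
    · exact ⟨⟨k, j⟩, ⟨k.2, hlt, hne⟩, rfl⟩
    · exact ⟨⟨j, k⟩, ⟨j.2, hlt, hne.symm⟩, by simp only [swappedResidues, Equiv.swap_comm]⟩
  · rintro ⟨⟨k, j⟩, ⟨hk, hj, hne⟩, rfl⟩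
    exact ⟨(swappedResidues_ne_zero_iff (hj.trans hk)).2 hne, ⟨j, hj.trans hk⟩, ⟨k, hk⟩,
      fun h => hj.ne (Fin.ext_iff.1 h), rfl⟩

theorem ncard_nbrSet_top_swappedResidues (n : ℕ) :
    (nbrSet (⊤ : SimpleGraph (Fin n)) (swappedResidues n 0 0).1
      (swappedResidues n 0 0).2).ncard = 3 * n ^ 2 / 8 := by
  rw [nbrSet_top_swappedResidues, (swappedResidues_injOn n).ncard_image,
    Set.ncard_coe_finset, card_incongruentPairs]

/-- over the complete interaction graph `K_n`, the degree upper bounds of the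
induced graph are attained by some vertex `(q, p)`. -/
theorem inducedGraph_degree_bounds_attained (n : ℕ) (hn : 1 ≤ n) :
    ∃ q p : Qn n,
      (n % 4 = 0 → (nbrSet (⊤ : SimpleGraph (Fin n)) q p).ncard = 3 * n ^ 2 / 8) ∧
      (n % 4 = 1 → (nbrSet (⊤ : SimpleGraph (Fin n)) q p).ncard = (3 * n ^ 2 - 3) / 8) ∧
      (n % 4 = 2 → (nbrSet (⊤ : SimpleGraph (Fin n)) q p).ncard = (3 * n ^ 2 - 4) / 8) ∧
      (n % 4 = 3 → (nbrSet (⊤ : SimpleGraph (Fin n)) q p).ncard = (3 * n ^ 2 - 3) / 8) := by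
  refine ⟨(swappedResidues n 0 0).1, (swappedResidues n 0 0).2, ?_⟩
  rw [ncard_nbrSet_top_swappedResidues]
  have hmod : n ^ 2 % 8 = (n % 8) ^ 2 % 8 := Nat.pow_mod n 2 8
  have hlt : n % 8 < 8 := Nat.mod_lt n (by norm_num)
  generalize hr : n % 8 = r at hmod hlt
  interval_cases r <;> omega
end
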